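/- arXiv:2108.00130 — 2 statements merged into one kernel-verified Lean document; each statement's English description precedes it below -/
import Mathlib

section
/- For all ε', ε ∈ ℝ and all τ ∈ ℂ with Im τ > 0, the function z ↦ θ[ε';ε](z,τ) vanishes at z₀ = τ(1/2 − ε') + 1/2 − ε, and its zero set is exactly the translate lattice z₀ + ℤ + ℤτ; in particular each fundamental parallelogram of the lattice ℤ + ℤτ contains a unique zero, and this zero is simple. -/
open Complex

/-- The theta function with characteristic `[ε'; ε]`:
`θ[ε';ε](z,τ) = Σ_{n∈ℤ} exp(πi(n+ε')²τ + 2πi(n+ε')(z+ε))`. -/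
noncomputable def jacobiThetaChar (ε' ε : ℝ) (z τ : ℂ) : ℂ :=
  ∑' n : ℤ, Complex.exp ((Real.pi : ℂ) * Complex.I * ((n : ℂ) + (ε' : ℂ)) ^ 2 * τ +
    2 * (Real.pi : ℂ) * Complex.I * ((n : ℂ) + (ε' : ℂ)) * (z + (ε : ℂ)))

/-- The theta derivative `θ'[ε';ε](0,τ) = ∂_z θ[ε';ε](z,τ) |_{z=0}`. -/
noncomputable def jacobiThetaCharDeriv (ε' ε : ℝ) (τ : ℂ) : ℂ :=
  deriv (fun z => jacobiThetaChar ε' ε z τ) 0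

open Filter Topology

noncomputable def thA (q w : ℂ) : ℂ := ∏' n : ℕ, (1 + q ^ (2 * n + 1) * w)

lemma thA_summable {q : ℂ} (hq : ‖q‖ < 1) (w : ℂ) :
    Summable (fun n : ℕ => ‖q ^ (2 * n + 1) * w‖) := by
  simp only [norm_mul, norm_pow]
  apply Summable.mul_right
  have h := summable_geometric_of_lt_one (norm_nonneg q) hq
  exact h.comp_injective (i := fun n : ℕ => 2 * n + 1) (fun a b h => by simpa using h)

lemma thA_ne_zero {q w : ℂ} (hq : ‖q‖ < 1) (h : ∀ n : ℕ, 1 + q ^ (2 * n + 1) * w ≠ 0) :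
    thA q w ≠ 0 :=
  tprod_one_add_ne_zero_of_summable h (thA_summable hq w)

lemma thA_step {q : ℂ} (hq : ‖q‖ < 1) (w : ℂ) :
    thA q w = (1 + q * w) * thA q (q ^ 2 * w) := by
  unfold thA
  rw [tprod_eq_zero_mul']
  · simp only [mul_zero, zero_add, pow_one]
    congr 2
    funext n
    ring
  · have := multipliable_one_add_of_summable (thA_summable hq (q ^ 2 * w))
    refine this.congr fun n => ?_
    ring

lemma thA_differentiable {q : ℂ} (hq : ‖q‖ < 1) : Differentiable ℂ (thA q) := by
  intro w
  have key : DifferentiableOn ℂ (thA q) (Metric.ball 0 (‖w‖ + 1)) := by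
    refine TendstoLocallyUniformlyOn.differentiableOn
      (hasProdLocallyUniformlyOn_iff_tendstoLocallyUniformlyOn.1 <| Summable.hasProdLocallyUniformlyOn_nat_one_add Metric.isOpen_ball
        (thA_summable hq ((‖w‖ + 1 : ℝ) : ℂ)) (.of_forall fun n x hx => ?_)
        (fun _ => by fun_prop)) (.of_forall fun _ ↦ by
        simpa [Finset.prod_fn] using
          DifferentiableOn.finsetProd (fun _ _ ↦ by fun_prop)) Metric.isOpen_ball
    rw [norm_mul, norm_mul]
    gcongr
    rw [Complex.norm_real, Real.norm_eq_abs, abs_of_nonneg (by positivity)]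
    simpa using (Metric.mem_ball.1 hx).le
  exact key.differentiableAt (Metric.isOpen_ball.mem_nhds (by simp))

/-- Quasi-periodicity. -/
def QP (τ : ℂ) (F : ℂ → ℂ) : Prop :=
  Differentiable ℂ F ∧ (∀ z, F (z + 1) = F z) ∧
    ∀ z, F (z + τ) = cexp (-Real.pi * I * (τ + 2 * z)) * F z

lemma QP.deriv_one {τ : ℂ} {F : ℂ → ℂ} (h : QP τ F) (z : ℂ) : deriv F (z + 1) = deriv F z := by
  rw [← deriv_comp_add_const]
  congr 1
  funext x
  exact h.2.1 x

lemma QP.deriv_tau {τ : ℂ} {F : ℂ → ℂ} (h : QP τ F) (z : ℂ) (hz : F z = 0) :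
    deriv F (z + τ) = cexp (-Real.pi * I * (τ + 2 * z)) * deriv F z := by
  rw [← deriv_comp_add_const]
  have : (fun x => F (x + τ)) = fun x => cexp (-Real.pi * I * (τ + 2 * x)) * F x := by
    funext x; exact h.2.2 x
  rw [this, deriv_fun_mul (by fun_prop) (h.1 z), hz]
  simp

/-- invariance under the lattice -/
lemma lattice_inv {p : ℂ → Prop} {τ : ℂ} (h1 : ∀ z, p (z + 1) ↔ p z) (h2 : ∀ z, p (z + τ) ↔ p z)
    (n m : ℤ) (z : ℂ) : p (z + n + m * τ) ↔ p z := by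
  have A : ∀ (n : ℤ) z, p (z + n) ↔ p z := by
    intro n
    induction n using Int.induction_on with
    | zero => simp
    | succ k ih => intro z; rw [← ih z, ← h1 (z + ((k : ℤ) : ℂ))]; push_cast; ring_nf
    | pred k ih => intro z; rw [← ih z, ← h1 (z + ((-(k:ℤ) - 1 : ℤ) : ℂ))]; push_cast; ring_nf
  have B : ∀ (n : ℤ) z, p (z + n * τ) ↔ p z := by
    intro n
    induction n using Int.induction_on with
    | zero => simp
    | succ k ih => intro z; rw [← ih z, ← h2 (z + ((k : ℤ) : ℂ) * τ)]; push_cast; ring_nf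
    | pred k ih => intro z; rw [← ih z, ← h2 (z + ((-(k:ℤ) - 1 : ℤ) : ℂ) * τ)]; push_cast; ring_nf
  rw [B, A]

lemma QP.zero_inv {τ : ℂ} {F : ℂ → ℂ} (h : QP τ F) (n m : ℤ) (z : ℂ) :
    F (z + n + m * τ) = 0 ↔ F z = 0 := by
  refine lattice_inv (p := fun z => F z = 0) (fun z => ?_) (fun z => ?_) n m z
  · rw [h.2.1]
  · rw [h.2.2]; simp

lemma QP.simple_inv {τ : ℂ} {F : ℂ → ℂ} (h : QP τ F) (n m : ℤ) (z : ℂ) :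
    (F (z + n + m * τ) = 0 ∧ deriv F (z + n + m * τ) ≠ 0) ↔ (F z = 0 ∧ deriv F z ≠ 0) := by
  refine lattice_inv (p := fun z => F z = 0 ∧ deriv F z ≠ 0) (fun z => ?_) (fun z => ?_) n m z
  · rw [h.2.1, h.deriv_one]
  · rw [h.2.2]
    simp only [mul_eq_zero, Complex.exp_ne_zero, false_or]
    refine and_congr_right fun hz => ?_
    rw [h.deriv_tau z hz]
    simp

lemma coords {τ : ℂ} (hτ : 0 < τ.im) (z : ℂ) : ∃ x y : ℝ, z = x + y * τ := by
  refine ⟨z.re - z.im / τ.im * τ.re, z.im / τ.im, ?_⟩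
  apply Complex.ext
  · simp
  · simp; field_simp

lemma quot_const {τ : ℂ} (hτ : 0 < τ.im) {F P : ℂ → ℂ} (hF : QP τ F) (hP : QP τ P)
    (hs : ∀ z, P z = 0 → deriv P z ≠ 0) (hz : ∀ z, P z = 0 → F z = 0) :
    ∃ c, ∀ z, F z = c * P z := by
  classical
  set h : ℂ → ℂ := fun z => if P z = 0 then deriv F z / deriv P z else F z / P z with hh
  have hd : Differentiable ℂ h := by
    intro z
    by_cases h0 : P z = 0
    · have hPd : Differentiable ℂ (dslope P z) := by
        rw [← differentiableOn_univ, Complex.differentiableOn_dslope univ_mem]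
        exact hP.1.differentiableOn
      have hFd : Differentiable ℂ (dslope F z) := by
        rw [← differentiableOn_univ, Complex.differentiableOn_dslope univ_mem]
        exact hF.1.differentiableOn
      have hne : dslope P z z ≠ 0 := by rw [dslope_same]; exact hs z h0
      have : h =ᶠ[𝓝 z] fun w => dslope F z w / dslope P z w := by
        filter_upwards [hPd.continuous.continuousAt.eventually_ne hne] with w hw
        by_cases hwz : w = z
        · subst hwz; simp [hh, h0]
        · have hsub : w - z ≠ 0 := sub_ne_zero.2 hwz
          rw [dslope_of_ne _ hwz, slope_def_field, h0, sub_zero] at hw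
          rw [dslope_of_ne _ hwz, dslope_of_ne _ hwz, slope_def_field, slope_def_field, hz z h0, h0,
            sub_zero, sub_zero]
          have hPw : P w ≠ 0 := by
            intro h; rw [h] at hw; simp at hw
          simp only [hh, hPw, if_false]
          field_simp
      exact DifferentiableAt.congr_of_eventuallyEq ((hFd z).fun_div (hPd z) hne) this
    · have : h =ᶠ[𝓝 z] fun w => F w / P w := by
        filter_upwards [hP.1.continuous.continuousAt.eventually_ne h0] with w hw
        simp [hh, hw]
      exact DifferentiableAt.congr_of_eventuallyEq ((hF.1 z).fun_div (hP.1 z) h0) this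
  have h1 : ∀ z, h (z + 1) = h z := by
    intro z
    simp only [hh, hP.2.1, hF.2.1, hP.deriv_one, hF.deriv_one]
  have h2 : ∀ z, h (z + τ) = h z := by
    intro z
    have he := Complex.exp_ne_zero (-Real.pi * I * (τ + 2 * z))
    simp only [hh, hP.2.2, hF.2.2, mul_eq_zero, he, false_or]
    by_cases h0 : P z = 0
    · rw [if_pos h0, if_pos h0, hP.deriv_tau z h0, hF.deriv_tau z (hz z h0),
        mul_div_mul_left _ _ he]
    · rw [if_neg h0, if_neg h0, mul_div_mul_left _ _ he]
  have hb : Bornology.IsBounded (Set.range h) := by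
    have hK : IsCompact ((fun p : ℝ × ℝ => h (p.1 + p.2 * τ)) '' (Set.Icc 0 1 ×ˢ Set.Icc 0 1)) := by
      apply (isCompact_Icc.prod isCompact_Icc).image
      have := hd.continuous
      fun_prop
    refine hK.isBounded.subset ?_
    rintro _ ⟨z, rfl⟩
    obtain ⟨x, y, rfl⟩ := coords hτ z
    refine ⟨(Int.fract x, Int.fract y), ⟨⟨Int.fract_nonneg _, (Int.fract_lt_one _).le⟩,
      ⟨Int.fract_nonneg _, (Int.fract_lt_one _).le⟩⟩, ?_⟩
    have := lattice_inv (p := fun w => h w = h (x + y * τ)) (τ := τ) (fun z => by rw [h1])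
      (fun z => by rw [h2]) (-⌊x⌋) (-⌊y⌋) (x + y * τ)
    simp only [iff_true] at this
    refine Eq.trans ?_ this
    simp only [Int.fract]
    congr 1
    push_cast
    ring
  obtain ⟨c, hc⟩ := hd.exists_const_forall_eq_of_bounded hb
  refine ⟨c, fun z => ?_⟩
  by_cases h0 : P z = 0
  · rw [h0, hz z h0, mul_zero]
  · rw [← hc z]; simp only [hh, h0, if_false]; field_simp

lemma theta_QP {τ : ℂ} (hτ : 0 < τ.im) : QP τ (fun z => jacobiTheta₂ z τ) :=
  ⟨fun z => differentiableAt_jacobiTheta₂_fst z hτ, fun z => jacobiTheta₂_add_left z τ,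
    fun z => jacobiTheta₂_add_left' z τ⟩

lemma theta_zero (τ : ℂ) : jacobiTheta₂ ((1 + τ) / 2) τ = 0 := by
  have h1 := jacobiTheta₂_add_left' ((1 - τ) / 2) τ
  have h2 := jacobiTheta₂_neg_left ((1 - τ) / 2) τ
  have h3 := jacobiTheta₂_add_left (-((1 - τ) / 2)) τ
  have e1 : (1 - τ) / 2 + τ = (1 + τ) / 2 := by ring
  have e2 : -((1 - τ) / 2) + 1 = (1 + τ) / 2 := by ring
  have e3 : -(Real.pi : ℂ) * I * (τ + 2 * ((1 - τ) / 2)) = -(Real.pi * I) := by ring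
  rw [e1, e3, Complex.exp_neg, Complex.exp_pi_mul_I] at h1
  rw [e2, h2] at h3
  rw [← h3] at h1
  norm_num at h1
  exact self_eq_neg.1 h1

lemma theta_ne {τ : ℂ} (hτ : 0 < τ.im) : ∃ z, jacobiTheta₂ z τ ≠ 0 := by
  by_contra! hcon
  have hsum := summable_pow_mul_jacobiTheta₂_term_bound 0 hτ 0
  have key : HasSum (fun n : ℤ => ∫ x in (0:ℝ)..1, jacobiTheta₂_term n x τ)
      (∫ x in (0:ℝ)..1, jacobiTheta₂ x τ) := by
    refine intervalIntegral.hasSum_integral_of_dominated_convergence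
      (fun n _ => (|n| ^ 0 : ℝ) * Real.exp (-Real.pi * (τ.im * n ^ 2 - 2 * 0 * |n|))) ?_ ?_ ?_ ?_ ?_
    · intro n
      apply Continuous.aestronglyMeasurable
      unfold jacobiTheta₂_term
      fun_prop
    · intro n
      refine .of_forall fun t _ => ?_
      rw [pow_zero, one_mul]
      exact norm_jacobiTheta₂_term_le hτ (by simp) le_rfl n
    · exact .of_forall fun t _ => hsum
    · exact intervalIntegrable_const
    · exact .of_forall fun t _ => hasSum_jacobiTheta₂_term t hτ
  simp only [hcon, intervalIntegral.integral_zero] at key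
  have h0 : ∀ n : ℤ, n ≠ 0 → ∫ x in (0:ℝ)..1, jacobiTheta₂_term n x τ = 0 := by
    intro n hn
    have hc : (2 * Real.pi * I * n : ℂ) ≠ 0 := by
      simp [Real.pi_ne_zero, hn]
    simp only [jacobiTheta₂_term, Complex.exp_add]
    rw [intervalIntegral.integral_mul_const, integral_exp_mul_complex hc]
    have : cexp (2 * Real.pi * I * n * (1 : ℝ)) = 1 := by
      rw [← Complex.exp_int_mul_two_pi_mul_I n]; congr 1; push_cast; ring
    rw [this]
    simp
  have := key.unique (hasSum_single 0 fun n hn => h0 n hn)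
  simp [jacobiTheta₂_term] at this

noncomputable def thP (τ z : ℂ) : ℂ :=
  thA (cexp (Real.pi * I * τ)) (cexp (2 * Real.pi * I * z)) *
    thA (cexp (Real.pi * I * τ)) (cexp (-(2 * Real.pi * I * z)))

lemma q_lt {τ : ℂ} (hτ : 0 < τ.im) : ‖cexp (Real.pi * I * τ)‖ < 1 := by
  rw [Complex.norm_exp]
  simp [Real.pi_pos, hτ]

lemma thP_QP {τ : ℂ} (hτ : 0 < τ.im) : QP τ (thP τ) := by
  have hq := q_lt hτ
  have hA := thA_differentiable hq
  refine ⟨?_, fun z => ?_, fun z => ?_⟩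
  · unfold thP
    fun_prop
  · unfold thP
    have e1 : cexp (2 * Real.pi * I * (z + 1)) = cexp (2 * Real.pi * I * z) := by
      rw [mul_add, mul_one, Complex.exp_add, Complex.exp_two_pi_mul_I, mul_one]
    rw [Complex.exp_neg, Complex.exp_neg, e1]
  · unfold thP
    set q := cexp (Real.pi * I * τ) with hqd
    set w := cexp (2 * Real.pi * I * z) with hw
    have q0 : q ≠ 0 := Complex.exp_ne_zero _
    have w0 : w ≠ 0 := Complex.exp_ne_zero _
    have e1 : cexp (2 * Real.pi * I * (z + τ)) = q ^ 2 * w := by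
      rw [hqd, hw, ← Complex.exp_nat_mul, ← Complex.exp_add]; congr 1; push_cast; ring
    have e2 : cexp (-Real.pi * I * (τ + 2 * z)) = (q * w)⁻¹ := by
      rw [hqd, hw, ← Complex.exp_add, ← Complex.exp_neg]; congr 1; ring
    rw [Complex.exp_neg, Complex.exp_neg, e1, e2, ← hw]
    have s1 := thA_step hq w
    have s2 := thA_step hq (q ^ 2 * w)⁻¹
    have e3 : q ^ 2 * (q ^ 2 * w)⁻¹ = w⁻¹ := by field_simp
    rw [e3] at s2
    rw [s1, s2]
    field_simp
    ring

lemma thP_zero {τ : ℂ} (hτ : 0 < τ.im) {z : ℂ} (h : thP τ z = 0) :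
    ∃ n m : ℤ, z = (1 + τ) / 2 + n + m * τ := by
  have hq := q_lt hτ
  have aux : ∀ u : ℂ, thA (cexp (Real.pi * I * τ)) (cexp (2 * Real.pi * I * u)) = 0 →
      ∃ n m : ℤ, u = (1 + τ) / 2 + n + m * τ := by
    intro u hu
    have : ∃ n : ℕ, 1 + cexp (Real.pi * I * τ) ^ (2 * n + 1) * cexp (2 * Real.pi * I * u) = 0 := by
      by_contra! hc
      exact thA_ne_zero hq hc hu
    obtain ⟨n, hn⟩ := this
    rw [← Complex.exp_nat_mul, ← Complex.exp_add, add_comm, add_eq_zero_iff_eq_neg,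
      ← Complex.exp_pi_mul_I, Complex.exp_eq_exp_iff_exists_int] at hn
    obtain ⟨k, hk⟩ := hn
    refine ⟨k, -n - 1, ?_⟩
    have hp : (2 * Real.pi * I : ℂ) ≠ 0 := Complex.two_pi_I_ne_zero
    apply mul_left_cancel₀ hp
    push_cast at hk ⊢
    linear_combination hk
  rcases mul_eq_zero.1 h with h | h
  · exact aux z h
  · rw [← mul_neg] at h
    obtain ⟨n, m, hnm⟩ := aux _ h
    refine ⟨-n - 1, -m - 1, ?_⟩
    push_cast
    linear_combination -hnm

lemma thP_simple {τ : ℂ} (hτ : 0 < τ.im) :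
    thP τ ((1 + τ) / 2) = 0 ∧ deriv (thP τ) ((1 + τ) / 2) ≠ 0 := by
  have hq := q_lt hτ
  have hA := thA_differentiable hq
  set q := cexp (Real.pi * I * τ) with hqd
  have q0 : q ≠ 0 := Complex.exp_ne_zero _
  set z0 := (1 + τ) / 2 with hz0
  set B : ℂ → ℂ := fun z => thA q (q ^ 2 * cexp (-(2 * Real.pi * I * z))) *
    thA q (cexp (2 * Real.pi * I * z)) with hB
  set C : ℂ → ℂ := fun z => 1 + q * cexp (-(2 * Real.pi * I * z)) with hC
  have e : thP τ = fun z => C z * B z := by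
    funext z
    simp only [thP, hC, hB]
    rw [← hqd, thA_step hq (cexp (-(2 * Real.pi * I * z)))]
    ring
  have w0 : cexp (2 * Real.pi * I * z0) = -q := by
    have : 2 * Real.pi * I * z0 = Real.pi * I + Real.pi * I * τ := by rw [hz0]; ring
    rw [this, Complex.exp_add, Complex.exp_pi_mul_I]; ring
  have w1 : cexp (-(2 * Real.pi * I * z0)) = -q⁻¹ := by
    rw [Complex.exp_neg, w0, inv_neg]
  have hC0 : C z0 = 0 := by
    simp only [hC, w1]; field_simp; ring
  have hAq : thA q (-q) ≠ 0 := by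
    apply thA_ne_zero hq
    intro n hn
    have : q ^ (2 * n + 2) = 1 := by linear_combination -hn
    have h2 : ‖q‖ ^ (2 * n + 2) = 1 := by rw [← norm_pow, this, norm_one]
    exact (pow_lt_one₀ (norm_nonneg q) hq (by omega)).ne h2
  have hB0 : B z0 ≠ 0 := by
    simp only [hB, w0, w1]
    have : q ^ 2 * -q⁻¹ = -q := by field_simp
    rw [this]
    exact mul_ne_zero hAq hAq
  have hBd : DifferentiableAt ℂ B z0 := by
    simp only [hB]; fun_prop
  have hCd : HasDerivAt C (q * (cexp (-(2 * Real.pi * I * z0)) * -(2 * Real.pi * I * 1))) z0 :=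
    (((((hasDerivAt_id z0).const_mul (2 * Real.pi * I : ℂ)).fun_neg).cexp).const_mul q).const_add 1
  rw [e]
  refine ⟨by simp only [hC0, zero_mul], ?_⟩
  rw [deriv_fun_mul hCd.differentiableAt hBd, hC0, hCd.deriv, w1, zero_mul, add_zero]
  refine mul_ne_zero ?_ hB0
  simp [q0, Real.pi_ne_zero]

lemma theta_main {τ : ℂ} (hτ : 0 < τ.im) :
    (∀ z, jacobiTheta₂ z τ = 0 ↔ ∃ n m : ℤ, z = (1 + τ) / 2 + n + m * τ) ∧
    ∀ z, jacobiTheta₂ z τ = 0 → deriv (fun z => jacobiTheta₂ z τ) z ≠ 0 := by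
  have hP := thP_QP hτ
  have hF := theta_QP hτ
  have hs : ∀ z, thP τ z = 0 → deriv (thP τ) z ≠ 0 := by
    intro z hz
    obtain ⟨n, m, rfl⟩ := thP_zero hτ hz
    exact ((hP.simple_inv n m _).2 (thP_simple hτ)).2
  have hl : ∀ n m : ℤ, jacobiTheta₂ ((1 + τ) / 2 + n + m * τ) τ = 0 := fun n m =>
    (hF.zero_inv n m _).2 (theta_zero τ)
  obtain ⟨c, hc⟩ := quot_const hτ hF hP hs (by
    intro z hz
    obtain ⟨n, m, rfl⟩ := thP_zero hτ hz
    exact hl n m)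
  have c0 : c ≠ 0 := by
    rintro rfl
    obtain ⟨z, hz⟩ := theta_ne hτ
    exact hz (by simpa using hc z)
  have hz : ∀ z, jacobiTheta₂ z τ = 0 → thP τ z = 0 := by
    intro z hz
    have := hc z
    simp only [hz] at this
    exact (mul_eq_zero.1 this.symm).resolve_left c0
  refine ⟨fun z => ⟨fun h => thP_zero hτ (hz z h), ?_⟩, fun z h => ?_⟩
  · rintro ⟨n, m, rfl⟩
    exact hl n m
  · have : (fun z => jacobiTheta₂ z τ) = fun z => c * thP τ z := funext hc
    rw [this, deriv_const_mul _ (hP.1 z)]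
    exact mul_ne_zero c0 (hs z (hz z h))

lemma char_eq (ε' ε : ℝ) (z τ : ℂ) : jacobiThetaChar ε' ε z τ =
    cexp (Real.pi * I * ε' ^ 2 * τ + 2 * Real.pi * I * ε' * (z + ε)) *
      jacobiTheta₂ (z + (ε + ε' * τ)) τ := by
  unfold jacobiThetaChar jacobiTheta₂
  rw [← tsum_mul_left]
  refine tsum_congr fun n => ?_
  rw [jacobiTheta₂_term, ← Complex.exp_add]
  congr 1
  ring

/-- `θ[ε';ε](·,τ)` vanishes at `z₀ = τ(1/2 − ε') + 1/2 − ε`, its zero set is exactly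
`z₀ + ℤ + ℤτ`, each fundamental parallelogram of the lattice `ℤ + ℤτ` contains a unique
zero, and every zero is simple. -/
theorem jacobiThetaChar_zeros (ε' ε : ℝ) (τ : ℂ) (hτ : 0 < τ.im) :
    jacobiThetaChar ε' ε (τ * ((1 : ℂ) / 2 - (ε' : ℂ)) + 1 / 2 - (ε : ℂ)) τ = 0 ∧
    (∀ z : ℂ, jacobiThetaChar ε' ε z τ = 0 ↔
      ∃ n m : ℤ, z = τ * ((1 : ℂ) / 2 - (ε' : ℂ)) + 1 / 2 - (ε : ℂ) + (n : ℂ) + (m : ℂ) * τ) ∧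
    (∀ w : ℂ, ∃! z : ℂ,
      (∃ a b : ℝ, a ∈ Set.Ico (0 : ℝ) 1 ∧ b ∈ Set.Ico (0 : ℝ) 1 ∧
        z = w + (a : ℂ) + (b : ℂ) * τ) ∧ jacobiThetaChar ε' ε z τ = 0) ∧
    (∀ z : ℂ, jacobiThetaChar ε' ε z τ = 0 →
      deriv (fun w => jacobiThetaChar ε' ε w τ) z ≠ 0) := by
  obtain ⟨hm, hd⟩ := theta_main hτ
  have h0 : ∀ z, jacobiThetaChar ε' ε z τ = 0 ↔ jacobiTheta₂ (z + (ε + ε' * τ)) τ = 0 := by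
    intro z
    rw [char_eq]
    simp
  have hz : ∀ z : ℂ, jacobiThetaChar ε' ε z τ = 0 ↔
      ∃ n m : ℤ, z = τ * ((1 : ℂ) / 2 - (ε' : ℂ)) + 1 / 2 - (ε : ℂ) + (n : ℂ) + (m : ℂ) * τ := by
    intro z
    rw [h0, hm]
    refine exists_congr fun n => exists_congr fun m => ⟨fun h => ?_, fun h => ?_⟩
    · linear_combination h
    · linear_combination h
  refine ⟨(hz _).2 ⟨0, 0, by simp⟩, hz, fun w => ?_, fun z h => ?_⟩
  · set z0 : ℂ := τ * ((1 : ℂ) / 2 - (ε' : ℂ)) + 1 / 2 - (ε : ℂ) with hz0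
    obtain ⟨x, y, hxy⟩ := coords hτ (z0 - w)
    refine ⟨w + (Int.fract x : ℝ) + (Int.fract y : ℝ) * τ, ⟨⟨Int.fract x, Int.fract y,
      ⟨Int.fract_nonneg _, Int.fract_lt_one _⟩, ⟨Int.fract_nonneg _, Int.fract_lt_one _⟩, rfl⟩,
      (hz _).2 ⟨-⌊x⌋, -⌊y⌋, ?_⟩⟩, ?_⟩
    · simp only [Int.fract]
      push_cast
      linear_combination -hxy
    · rintro z ⟨⟨a, b, ha, hb, rfl⟩, h⟩
      obtain ⟨n, m, hnm⟩ := (hz _).1 h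
      have e : ((a - x - n : ℝ) : ℂ) + ((b - y - m : ℝ) : ℂ) * τ = 0 := by
        push_cast
        linear_combination hnm + hxy
      have him := congrArg Complex.im e
      simp [-ofReal_sub] at him
      have hb' : b - y - m = 0 := him.resolve_right hτ.ne'
      rw [hb'] at e
      have hre := congrArg Complex.re e
      simp [-ofReal_sub] at hre
      have ea : Int.fract x = a := by
        rw [Int.fract_eq_iff]
        exact ⟨ha.1, ha.2, -n, by push_cast; linarith⟩
      have eb : Int.fract y = b := by
        rw [Int.fract_eq_iff]
        exact ⟨hb.1, hb.2, -m, by push_cast; linarith⟩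
      rw [ea, eb]
  · have h' := (h0 z).1 h
    have hF := (theta_QP hτ).1
    have e : (fun w => jacobiThetaChar ε' ε w τ) = fun w =>
        cexp (Real.pi * I * ε' ^ 2 * τ + 2 * Real.pi * I * ε' * (w + ε)) *
        (fun u => jacobiTheta₂ u τ) (w + (ε + ε' * τ)) := funext fun w => char_eq _ _ _ _
    rw [e, deriv_fun_mul (by fun_prop) (by fun_prop),
      deriv_comp_add_const (fun u => jacobiTheta₂ u τ)]
    simp only [h', mul_zero, zero_add]
    exact mul_ne_zero (Complex.exp_ne_zero _) (hd _ h')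
end

section
/- (Fundamental theta derivative identity) For all ε', ε ∈ ℝ and all τ ∈ ℂ with Im τ > 0, θ[ε';ε](0,τ)² · ( 3·θ[3ε';3ε](0,τ)·θ'[ε';ε](0,τ) − θ'[3ε';3ε](0,τ)·θ[ε';ε](0,τ) ) = exp(6πi ε') · θ'[1/2;1/2](0,τ) · θ[1/2 − 2ε'; 1/2 − 2ε](0,τ)³. -/
open Complex

theorem theta_term_eq (ε' ε : ℝ) (z τ : ℂ) (n : ℤ) :
    Complex.exp ((Real.pi : ℂ) * Complex.I * ((n : ℂ) + (ε' : ℂ)) ^ 2 * τ +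
    2 * (Real.pi : ℂ) * Complex.I * ((n : ℂ) + (ε' : ℂ)) * (z + (ε : ℂ))) =
    Complex.exp ((Real.pi : ℂ) * Complex.I * (ε' : ℂ) ^ 2 * τ +
      2 * (Real.pi : ℂ) * Complex.I * ε' * (z + ε)) * jacobiTheta₂_term n (z + ε + ε' * τ) τ := by
  rw [jacobiTheta₂_term, ← Complex.exp_add]
  congr 1
  ring

theorem theta_summable (ε' ε : ℝ) (z τ : ℂ) (hτ : 0 < τ.im) :
    Summable fun n : ℤ => Complex.exp ((Real.pi : ℂ) * Complex.I * ((n : ℂ) + (ε' : ℂ)) ^ 2 * τ +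
    2 * (Real.pi : ℂ) * Complex.I * ((n : ℂ) + (ε' : ℂ)) * (z + (ε : ℂ))) := by
  simp_rw [theta_term_eq]
  exact ((summable_jacobiTheta₂_term_iff _ _).2 hτ).mul_left _

theorem theta_eq (ε' ε : ℝ) (z τ : ℂ) : jacobiThetaChar ε' ε z τ =
    Complex.exp ((Real.pi : ℂ) * Complex.I * (ε' : ℂ) ^ 2 * τ +
      2 * (Real.pi : ℂ) * Complex.I * ε' * (z + ε)) * jacobiTheta₂ (z + ε + ε' * τ) τ := by
  unfold jacobiThetaChar jacobiTheta₂
  simp_rw [theta_term_eq]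
  rw [tsum_mul_left]

theorem theta_diff (ε' ε : ℝ) (τ : ℂ) (hτ : 0 < τ.im) :
    Differentiable ℂ fun z => jacobiThetaChar ε' ε z τ := by
  intro z
  simp_rw [theta_eq]
  refine DifferentiableAt.mul (by fun_prop) ?_
  exact (differentiableAt_jacobiTheta₂_fst (z + ε + ε' * τ) hτ).comp z
    (f := fun z : ℂ => z + ε + ε' * τ) (by fun_prop)

noncomputable def thS (τ z : ℂ) : ℂ := jacobiThetaChar (1 / 2) (1 / 2) z τ

/-- shift of the characteristic -/
theorem theta_shift (a b : ℝ) (z τ : ℂ) : jacobiThetaChar (1 / 2 + a) (1 / 2 + b) z τ =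
    Complex.exp ((Real.pi : ℂ) * Complex.I * (a ^ 2 * τ + 2 * a * (z + b + 1 / 2))) *
      thS τ (z + (a * τ + b)) := by
  unfold thS jacobiThetaChar
  rw [← tsum_mul_left]
  refine tsum_congr fun n => ?_
  rw [← Complex.exp_add]
  congr 1
  push_cast
  ring

theorem theta_add_one (a b : ℝ) (z τ : ℂ) : jacobiThetaChar (a + 1) (b + 1) z τ =
    Complex.exp (2 * Real.pi * Complex.I * a) * jacobiThetaChar a b z τ := by
  unfold jacobiThetaChar
  rw [← tsum_mul_left, ← (Equiv.addRight (1 : ℤ)).tsum_eq (fun n : ℤ => _ * _)]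
  refine tsum_congr fun n => ?_
  rw [← Complex.exp_add, Complex.exp_eq_exp_iff_exists_int]
  refine ⟨n + 1, ?_⟩
  simp only [Equiv.coe_addRight]
  push_cast
  ring

theorem theta_neg (a b : ℝ) (τ : ℂ) : jacobiThetaChar (-a) (-b) 0 τ = jacobiThetaChar a b 0 τ := by
  unfold jacobiThetaChar
  rw [← (Equiv.neg ℤ).tsum_eq]
  refine tsum_congr fun n => ?_
  congr 1
  simp only [Equiv.neg_apply]
  push_cast
  ring

noncomputable def thE (τ z : ℂ) : ℂ :=
  ∑' n : ℤ, Complex.exp (Real.pi * Complex.I * (n : ℂ) ^ 2 * (2 * τ) +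
    2 * Real.pi * Complex.I * n * (2 * z))
noncomputable def thO (τ z : ℂ) : ℂ :=
  ∑' n : ℤ, Complex.exp (Real.pi * Complex.I * ((n : ℂ) + 1 / 2) ^ 2 * (2 * τ) +
    2 * Real.pi * Complex.I * ((n : ℂ) + 1 / 2) * (2 * z))

theorem sumE (τ z : ℂ) (hτ : 0 < τ.im) : Summable fun n : ℤ =>
    Complex.exp (Real.pi * Complex.I * (n : ℂ) ^ 2 * (2 * τ) +
    2 * Real.pi * Complex.I * n * (2 * z)) := by
  have := theta_summable 0 0 (2 * z) (2 * τ) (by simpa using hτ)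
  simpa using this

theorem sumO (τ z : ℂ) (hτ : 0 < τ.im) : Summable fun n : ℤ =>
    Complex.exp (Real.pi * Complex.I * ((n : ℂ) + 1 / 2) ^ 2 * (2 * τ) +
    2 * Real.pi * Complex.I * ((n : ℂ) + 1 / 2) * (2 * z)) := by
  have := theta_summable (1 / 2) 0 (2 * z) (2 * τ) (by simpa using hτ)
  simpa using this

theorem prod_hasSum {f g : ℤ → ℂ} (hf : Summable f) (hg : Summable g) :
    HasSum (fun p : ℤ × ℤ => f p.1 * g p.2) ((∑' n, f n) * ∑' n, g n) := by
  have h := summable_mul_of_summable_norm hf.norm hg.norm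
  rw [tsum_mul_tsum_of_summable_norm hf.norm hg.norm]
  exact h.hasSum

theorem bij : Function.Bijective
    (Sum.elim (fun p : ℤ × ℤ => (p.1 + p.2, p.1 - p.2 - 1)) (fun p : ℤ × ℤ => (p.1 + p.2, p.1 - p.2))) := by
  constructor
  · rintro (⟨a, b⟩ | ⟨a, b⟩) (⟨c, d⟩ | ⟨c, d⟩) h <;> simp only [Sum.elim_inl, Sum.elim_inr, Prod.mk.injEq] at h <;>
      simp only [Sum.inl.injEq, Sum.inr.injEq, Prod.mk.injEq, reduceCtorEq] <;> omega
  · rintro ⟨n, m⟩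
    rcases Int.even_or_odd' (n + m) with ⟨k, h | h⟩
    · exact ⟨Sum.inr (k, n - k), by simp only [Sum.elim_inr, Prod.mk.injEq]; omega⟩
    · exact ⟨Sum.inl (k + 1, n - k - 1), by simp only [Sum.elim_inl, Prod.mk.injEq]; omega⟩

theorem hasSum_sum_aux {f : (ℤ × ℤ) ⊕ (ℤ × ℤ) → ℂ} {a b : ℂ}
    (h₁ : HasSum (fun p => f (Sum.inl p)) a) (h₂ : HasSum (fun p => f (Sum.inr p)) b) :
    HasSum f (a + b) := by
  refine HasSum.add_isCompl (s := Set.range Sum.inl) (t := Set.range Sum.inr)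
    Set.isCompl_range_inl_range_inr ?_ ?_
  · exact (Sum.inl_injective.hasSum_range_iff).2 h₁
  · exact (Sum.inr_injective.hasSum_range_iff).2 h₂

theorem thS_mul (τ x y : ℂ) (hτ : 0 < τ.im) :
    thS τ (x + y) * thS τ (x - y) = thE τ x * thO τ y - thO τ x * thE τ y := by
  have h1 := prod_hasSum (theta_summable (1 / 2) (1 / 2) (x + y) τ hτ)
    (theta_summable (1 / 2) (1 / 2) (x - y) τ hτ)
  rw [← (Equiv.ofBijective _ bij).hasSum_iff] at h1
  have h2 := prod_hasSum (sumE τ x hτ) (sumO τ y hτ)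
  have h3 := (prod_hasSum (sumO τ x hτ) (sumE τ y hτ)).neg
  rw [sub_eq_add_neg (thE τ x * thO τ y)]
  refine h1.unique (hasSum_sum_aux ?_ ?_)
  · refine Eq.mp (congrArg (fun f => HasSum f _) (funext fun p => Eq.symm ?_)) h2
    obtain ⟨j, k⟩ := p
    simp only [Function.comp_apply, Equiv.ofBijective_apply, Sum.elim_inl]
    rw [← Complex.exp_add, ← Complex.exp_add, Complex.exp_eq_exp_iff_exists_int]
    refine ⟨j, ?_⟩
    push_cast
    ring
  · refine Eq.mp (congrArg (fun f => HasSum f _) (funext fun p => Eq.symm ?_)) h3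
    obtain ⟨j, k⟩ := p
    simp only [Function.comp_apply, Equiv.ofBijective_apply, Sum.elim_inr]
    rw [← Complex.exp_add, ← Complex.exp_add, neg_eq_neg_one_mul, ← Complex.exp_pi_mul_I,
      ← Complex.exp_add, Complex.exp_eq_exp_iff_exists_int]
    refine ⟨j, ?_⟩
    push_cast
    ring

theorem thS_diff (τ : ℂ) (hτ : 0 < τ.im) : Differentiable ℂ (thS τ) := theta_diff _ _ τ hτ

theorem thS_three (τ b c d : ℂ) (hτ : 0 < τ.im) :
    thS τ (c + d) * thS τ (c - d) * thS τ b ^ 2 =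
      thS τ (b + d) * thS τ (b - d) * thS τ c ^ 2 - thS τ (b + c) * thS τ (b - c) * thS τ d ^ 2 := by
  have hb := thS_mul τ b 0 hτ
  have hc := thS_mul τ c 0 hτ
  have hd := thS_mul τ d 0 hτ
  simp only [add_zero, sub_zero, ← sq] at hb hc hd
  rw [hb, hc, hd, thS_mul τ _ _ hτ, thS_mul τ _ _ hτ, thS_mul τ _ _ hτ]
  ring

theorem thS_key (τ u : ℂ) (hτ : 0 < τ.im) :
    thS τ u ^ 2 * (3 * thS τ (3 * u) * deriv (thS τ) u - deriv (thS τ) (3 * u) * thS τ u) =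
      deriv (thS τ) 0 * thS τ (2 * u) ^ 3 := by
  have hS : ∀ z, HasDerivAt (thS τ) (deriv (thS τ) z) z := fun z => (thS_diff τ hτ z).hasDerivAt
  have e := funext fun c => thS_three τ (2 * u) c u hτ
  have p1 := (hS (u + u)).comp_add_const u u
  have p2 := (hS (u - u)).comp_sub_const u u
  have p3 := (hS (2 * u + u)).comp_const_add (2 * u) u
  have p4 := (hS (2 * u - u)).comp_const_sub (2 * u) u
  have L := (p1.mul p2).mul_const (thS τ (2 * u) ^ 2)
  have R := (((hS u).pow 2).const_mul (thS τ (2 * u + u) * thS τ (2 * u - u))).sub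
    ((p3.mul p4).mul_const (thS τ u ^ 2))
  have h0 : thS τ 0 = 0 := by
    have := thS_mul τ 0 0 hτ
    simp only [add_zero, sub_zero] at this
    rw [mul_comm (thO τ 0), sub_self] at this
    exact mul_self_eq_zero.1 this
  have key := L.unique (R.congr_of_eventuallyEq (Filter.Eventually.of_forall fun c => congrFun e c))
  simp only [Function.comp_apply, id, sub_self, h0] at key
  rw [show 2 * u + u = 3 * u by ring, show 2 * u - u = u by ring, ← two_mul] at key
  linear_combination -key

/-- The fundamental theta derivative identity:
`θ[ε';ε](0,τ)² (3 θ[3ε';3ε](0,τ) θ'[ε';ε](0,τ) − θ'[3ε';3ε](0,τ) θ[ε';ε](0,τ))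
  = exp(6πi ε') θ'[1/2;1/2](0,τ) θ[1/2−2ε'; 1/2−2ε](0,τ)³`. -/
theorem fundamental_theta_derivative_identity (ε' ε : ℝ) (τ : ℂ) (hτ : 0 < τ.im) :
    jacobiThetaChar ε' ε 0 τ ^ 2 *
        (3 * jacobiThetaChar (3 * ε') (3 * ε) 0 τ * jacobiThetaCharDeriv ε' ε τ -
          jacobiThetaCharDeriv (3 * ε') (3 * ε) τ * jacobiThetaChar ε' ε 0 τ) =
      Complex.exp (6 * (Real.pi : ℂ) * Complex.I * (ε' : ℂ)) *
        jacobiThetaCharDeriv (1 / 2) (1 / 2) τ *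
        jacobiThetaChar (1 / 2 - 2 * ε') (1 / 2 - 2 * ε) 0 τ ^ 3 := by
  obtain ⟨a, rfl⟩ : ∃ a, ε' = 1 / 2 + a := ⟨ε' - 1 / 2, by ring⟩
  obtain ⟨b, rfl⟩ : ∃ b, ε = 1 / 2 + b := ⟨ε - 1 / 2, by ring⟩
  have hS : ∀ z, HasDerivAt (thS τ) (deriv (thS τ) z) z := fun z => (thS_diff τ hτ z).hasDerivAt
  have hd : ∀ a b : ℝ, jacobiThetaCharDeriv (1 / 2 + a) (1 / 2 + b) τ =
      Complex.exp ((Real.pi : ℂ) * Complex.I * (a ^ 2 * τ + 2 * a * (b + 1 / 2))) *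
      (2 * Real.pi * Complex.I * a * thS τ (a * τ + b) + deriv (thS τ) (a * τ + b)) := by
    intro a b
    unfold jacobiThetaCharDeriv
    simp_rw [theta_shift]
    have i := hasDerivAt_id (0 : ℂ)
    have h1 := (((((i.add_const (b : ℂ)).add_const (1 / 2 : ℂ)).const_mul (2 * (a : ℂ))).const_add
      ((a : ℂ) ^ 2 * τ)).const_mul ((Real.pi : ℂ) * Complex.I)).cexp
    have h2 := (hS (0 + (a * τ + b))).comp_add_const (0 : ℂ) (a * τ + b)
    refine (h1.mul h2).deriv.trans ?_
    simp only [Function.comp_apply, id, zero_add]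
    ring
  have e3 : ∀ z, jacobiThetaChar (3 * (1 / 2 + a)) (3 * (1 / 2 + b)) z τ =
      Complex.exp (2 * Real.pi * Complex.I * (1 / 2 + 3 * a)) *
        jacobiThetaChar (1 / 2 + 3 * a) (1 / 2 + 3 * b) z τ := by
    intro z
    rw [show 3 * (1 / 2 + a) = (1 / 2 + 3 * a) + 1 by ring,
      show 3 * (1 / 2 + b) = (1 / 2 + 3 * b) + 1 by ring, theta_add_one]
    push_cast
    rfl
  have d3 : jacobiThetaCharDeriv (3 * (1 / 2 + a)) (3 * (1 / 2 + b)) τ =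
      Complex.exp (2 * Real.pi * Complex.I * (1 / 2 + 3 * a)) *
        jacobiThetaCharDeriv (1 / 2 + 3 * a) (1 / 2 + 3 * b) τ := by
    unfold jacobiThetaCharDeriv
    simp_rw [e3]
    exact deriv_const_mul _ (theta_diff _ _ τ hτ 0)
  have e2 : jacobiThetaChar (1 / 2 - 2 * (1 / 2 + a)) (1 / 2 - 2 * (1 / 2 + b)) 0 τ =
      jacobiThetaChar (1 / 2 + 2 * a) (1 / 2 + 2 * b) 0 τ := by
    rw [← theta_neg (1 / 2 + 2 * a)]
    congr 1 <;> ring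
  have key := thS_key τ (a * τ + b) hτ
  have d0 : jacobiThetaCharDeriv (1 / 2) (1 / 2) τ = deriv (thS τ) 0 := rfl
  rw [e2, d3, e3, d0, hd, hd, theta_shift, theta_shift, theta_shift]
  push_cast
  simp only [zero_add]
  rw [show 3 * (a : ℂ) * τ + 3 * b = 3 * (a * τ + b) by ring,
    show 2 * (a : ℂ) * τ + 2 * b = 2 * (a * τ + b) by ring]
  have hE : Complex.exp ((Real.pi : ℂ) * Complex.I * (a ^ 2 * τ + 2 * a * (b + 1 / 2))) ^ 3 *
      Complex.exp (2 * Real.pi * Complex.I * (1 / 2 + 3 * a)) *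
      Complex.exp ((Real.pi : ℂ) * Complex.I * ((3 * a) ^ 2 * τ + 2 * (3 * a) * (3 * b + 1 / 2))) =
      Complex.exp (6 * (Real.pi : ℂ) * Complex.I * (1 / 2 + a)) *
      Complex.exp ((Real.pi : ℂ) * Complex.I *
        ((2 * a) ^ 2 * τ + 2 * (2 * a) * (2 * b + 1 / 2))) ^ 3 := by
    rw [← Complex.exp_nat_mul, ← Complex.exp_nat_mul, ← Complex.exp_add, ← Complex.exp_add,
      ← Complex.exp_add, Complex.exp_eq_exp_iff_exists_int]
    refine ⟨-1, ?_⟩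
    push_cast
    ring
  generalize Complex.exp ((Real.pi : ℂ) * Complex.I * (a ^ 2 * τ + 2 * a * (b + 1 / 2))) = E1 at *
  generalize Complex.exp (2 * Real.pi * Complex.I * (1 / 2 + 3 * a)) = K at *
  generalize Complex.exp ((Real.pi : ℂ) * Complex.I * ((3 * a) ^ 2 * τ + 2 * (3 * a) * (3 * b + 1 / 2))) = E3 at *
  linear_combination (E1 ^ 3 * K * E3) * key + deriv (thS τ) 0 * thS τ (2 * (a * τ + b)) ^ 3 * hE
end
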